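/- Let T > 0. Suppose α, β, γ_f, γ_b : [0,T] → ℝ are continuous, bounded and nonnegative, c : [0,T] → ℝ is continuous, bounded and nonnegative, and R : [0,T] × ℝ → ℝ is continuous, uniformly Lipschitz continuous in its second argument, and satisfies R(t, ξ) ≥ 0 whenever ξ ≥ 0. Then for any nonnegative initial values θ_f⁰, θ_b⁰ the system θ_f' = R(t, θ_f) − α(t)c(t)θ_f + β(t)θ_b − γ_f(t)θ_f, θ_b' = α(t)c(t)θ_f − β(t)θ_b − γ_b(t)θ_b has a unique C¹ solution (θ_f, θ_b) on [0,T]; this solution satisfies θ_f(t) ≥ 0 and θ_b(t) ≥ 0 for all t ∈ [0,T], and θ_f(t) + θ_b(t) ≤ (θ_f⁰ + θ_b⁰ + C₀T) e^{LT} for all t ∈ [0,T], where L is the Lipschitz constant of R and C₀ = sup_{t∈[0,T]} R(t,0); in particular the bound is independent of c. -/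

import Mathlib

open Set

namespace TransporterAux

noncomputable def clampP (M : ℝ) (p : ℝ × ℝ) : ℝ × ℝ :=
  (max (-M) (min M p.1), max (-M) (min M p.2))

lemma clampP_lip (M : ℝ) : LipschitzWith 1 (clampP M) := by
  have h1 : LipschitzWith 1 (fun p : ℝ × ℝ => max (-M) (min M p.1)) :=
    (LipschitzWith.prod_fst.const_min M).const_max (-M)
  have h2 : LipschitzWith 1 (fun p : ℝ × ℝ => max (-M) (min M p.2)) :=
    (LipschitzWith.prod_snd.const_min M).const_max (-M)
  simpa using! h1.prodMk h2

lemma clampP_le (M : ℝ) (hM : 0 ≤ M) (p : ℝ × ℝ) : ‖clampP M p‖ ≤ M := by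
  rw [norm_prod_le_iff]
  simp only [clampP, Real.norm_eq_abs, abs_le]
  grind

lemma clampP_eq (M : ℝ) (p : ℝ × ℝ) (hp : ‖p‖ ≤ M) : clampP M p = p := by
  rw [norm_prod_le_iff] at hp
  simp only [Real.norm_eq_abs, abs_le] at hp
  ext <;> simp only [clampP] <;> grind

lemma clampP_le_norm (M : ℝ) (hM : 0 ≤ M) (p : ℝ × ℝ) : ‖clampP M p‖ ≤ ‖p‖ := by
  have h := (clampP_lip M).dist_le_mul p 0
  have h0 : clampP M 0 = 0 := clampP_eq M 0 (by simpa using hM)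
  simpa [h0] using h

lemma exists_global (v : ℝ → ℝ × ℝ → ℝ × ℝ) (hc : ∀ x, Continuous (fun t => v t x))
    (K : NNReal) (hlip : ∀ t, LipschitzWith K (v t)) (T : ℝ) (hT : 0 < T) (x0 : ℝ × ℝ) :
    ∃ γ : ℝ → ℝ × ℝ, γ 0 = x0 ∧ ∀ t ∈ Icc 0 T, HasDerivAt γ (v t (γ t)) t := by
  obtain ⟨C, hC⟩ := (isCompact_Icc (a := (-1:ℝ)) (b := T+1)).exists_bound_of_continuousOn
    (hc 0).continuousOn
  have hC0 : 0 ≤ C := (norm_nonneg _).trans (hC 0 ⟨by linarith, by linarith⟩)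
  set M := gronwallBound ‖x0‖ K C T with hMdef
  have hmono := gronwallBound_mono (norm_nonneg x0) hC0 K.2
  have hM : 0 ≤ M := by
    have := hmono hT.le
    rw [gronwallBound_x0] at this
    exact (norm_nonneg _).trans this
  have hb : ∀ t ∈ Icc (-1:ℝ) (T+1), ∀ x, ‖v t x‖ ≤ K * ‖x‖ + C := by
    intro t ht x
    have h1 := (hlip t).dist_le_mul x 0
    rw [dist_eq_norm, dist_zero_right] at h1
    have h2 := hC t ht
    have h3 := norm_sub_norm_le (v t x) (v t 0)
    linarith
  have hB : 0 ≤ K * M + C := by positivity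
  let B : NNReal := ⟨K * M + C, hB⟩
  let a : NNReal := B * ⟨T + 1, by linarith⟩
  have hPL : IsPicardLindelof (fun t x => v t (clampP M x))
      (⟨0, by constructor <;> linarith⟩ : Icc (-1:ℝ) (T+1)) x0 a 0 B K := by
    refine ⟨?_, ?_, ?_, ?_⟩
    · intro t _
      have := (hlip t).comp (clampP_lip M)
      rw [mul_one] at this
      exact this.lipschitzOnWith
    · intro x _
      exact (hc _).continuousOn
    · intro t ht x _
      refine (hb t ht _).trans ?_
      change _ ≤ K * M + C
      have := mul_le_mul_of_nonneg_left (clampP_le M hM x) K.2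
      simpa using this
    · have : max (T + 1 - 0) (0 - (-1)) = T + 1 := by
        rw [max_eq_left] <;> linarith
      simp only [this]
      rw [NNReal.coe_zero, sub_zero]
      exact le_of_eq (NNReal.coe_mul B ⟨T + 1, by linarith⟩).symm
  obtain ⟨γ, hγ0, hγ⟩ := hPL.exists_eq_forall_mem_Icc_hasDerivWithinAt₀
  have hγ0' : γ 0 = x0 := hγ0
  have hd : ∀ t ∈ Icc 0 T, HasDerivAt γ (v t (clampP M (γ t))) t := by
    intro t ht
    exact (hγ t ⟨by linarith [ht.1], by linarith [ht.2]⟩).hasDerivAt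
      (Icc_mem_nhds (by linarith [ht.1]) (by linarith [ht.2]))
  have hG := norm_le_gronwallBound_of_norm_deriv_right_le (f := γ)
    (f' := fun t => v t (clampP M (γ t))) (δ := ‖x0‖) (K := K) (ε := C) (a := 0) (b := T)
    (fun t ht => (hd t ht).continuousAt.continuousWithinAt)
    (fun t ht => (hd t (Ico_subset_Icc_self ht)).hasDerivWithinAt) (by rw [hγ0'])
    (fun t ht => by
      refine (hb t ⟨by linarith [ht.1], by linarith [ht.2]⟩ _).trans ?_
      have := mul_le_mul_of_nonneg_left (clampP_le_norm M hM (γ t)) K.2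
      simpa using this)
  refine ⟨γ, hγ0', fun t ht => ?_⟩
  have h1 := hd t ht
  rwa [clampP_eq M] at h1
  exact (hG t ht).trans (hmono (by linarith [ht.2]))

lemma nonneg_of_deriv (T : ℝ) (f f' g : ℝ → ℝ)
    (hf : ∀ t ∈ Icc 0 T, HasDerivAt f (f' t) t) (hg : ∀ t, 0 ≤ g t)
    (h : ∀ t ∈ Icc 0 T, - g t * f t ≤ f' t) (h0 : 0 ≤ f 0) :
    ∀ t ∈ Icc 0 T, 0 ≤ f t := by
  have key : ∀ ε > 0, ∀ t ∈ Icc 0 T, - f t ≤ ε * (1 + t) := by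
    intro ε hε t ht
    refine image_le_of_deriv_right_lt_deriv_boundary (f := fun t => - f t) (f' := fun t => - f' t)
      (B := fun t => ε * (1 + t)) (B' := fun _ => ε) (a := 0) (b := T)
      (fun t ht => (hf t ht).continuousAt.neg.continuousWithinAt)
      (fun t ht => (hf t (Ico_subset_Icc_self ht)).neg.hasDerivWithinAt)
      (by simp; linarith) (fun x => by
        simpa using ((hasDerivAt_id x).const_add 1).const_mul ε) ?_ ht
    intro x hx he
    have h1 := h x (Ico_subset_Icc_self hx)
    have h2 : f x ≤ 0 := by
      have : 0 ≤ ε * (1 + x) := mul_nonneg hε.le (by linarith [hx.1])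
      linarith
    have := mul_nonneg (hg x) (neg_nonneg.2 h2)
    nlinarith
  intro t ht
  by_contra! hn
  have h1 : 0 < 1 + t := by linarith [ht.1]
  have := key (- f t / (2 * (1 + t))) (by apply div_pos <;> linarith) t ht
  have e : - f t / (2 * (1 + t)) * (1 + t) = - f t / 2 := by field_simp
  rw [e] at this
  linarith

def fld (a b gf gb : ℝ → ℝ) (R : ℝ → ℝ → ℝ) (φ : ℝ → ℝ) (t : ℝ) (x : ℝ × ℝ) : ℝ × ℝ :=
  (R t (φ x.1) - a t * x.1 + b t * φ x.2 - gf t * x.1,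
    a t * φ x.1 - b t * x.2 - gb t * x.2)

lemma fld_lip (a b gf gb : ℝ → ℝ) (R : ℝ → ℝ → ℝ) (φ : ℝ → ℝ) (L A B F G : ℝ) (hL : 0 ≤ L)
    (hA : ∀ t, |a t| ≤ A) (hB : ∀ t, |b t| ≤ B) (hF : ∀ t, |gf t| ≤ F) (hG : ∀ t, |gb t| ≤ G)
    (hR : ∀ t ξ₁ ξ₂, |R t ξ₁ - R t ξ₂| ≤ L * |ξ₁ - ξ₂|)
    (hφ : ∀ x y, |φ x - φ y| ≤ |x - y|) (t : ℝ) :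
    LipschitzWith (Real.toNNReal (L + A + B + F + G)) (fld a b gf gb R φ t) := by
  have hA0 := (abs_nonneg _).trans (hA 0)
  have hB0 := (abs_nonneg _).trans (hB 0)
  have hF0 := (abs_nonneg _).trans (hF 0)
  have hG0 := (abs_nonneg _).trans (hG 0)
  refine LipschitzWith.of_dist_le_mul fun x y => ?_
  rw [Real.coe_toNNReal _ (by positivity)]
  set D := dist x y with hD
  have hD0 : 0 ≤ D := dist_nonneg
  have d1 : |x.1 - y.1| ≤ D := by
    rw [hD, Prod.dist_eq, ← Real.dist_eq]; exact le_max_left _ _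
  have d2 : |x.2 - y.2| ≤ D := by
    rw [hD, Prod.dist_eq, ← Real.dist_eq]; exact le_max_right _ _
  have p1 := (hφ x.1 y.1).trans d1
  have p2 := (hφ x.2 y.2).trans d2
  have r := (hR t (φ x.1) (φ y.1)).trans (mul_le_mul_of_nonneg_left p1 hL)
  have m : ∀ u w U : ℝ, |u| ≤ U → |w| ≤ D → |u * w| ≤ U * D := by
    intro u w U hu hw
    rw [abs_mul]
    exact mul_le_mul hu hw (abs_nonneg _) ((abs_nonneg _).trans hu)
  have m1 := abs_le.1 (m _ _ _ (hA t) d1)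
  have m2 := abs_le.1 (m _ _ _ (hA t) p1)
  have m3 := abs_le.1 (m _ _ _ (hB t) d2)
  have m4 := abs_le.1 (m _ _ _ (hB t) p2)
  have m5 := abs_le.1 (m _ _ _ (hF t) d1)
  have m6 := abs_le.1 (m _ _ _ (hG t) d2)
  have r' := abs_le.1 r
  have l1 := mul_nonneg hL hD0
  have l2 := mul_nonneg hA0 hD0
  have l3 := mul_nonneg hB0 hD0
  have l4 := mul_nonneg hF0 hD0
  have l5 := mul_nonneg hG0 hD0
  rw [Prod.dist_eq]
  refine max_le ?_ ?_ <;> rw [Real.dist_eq, abs_le] <;> simp only [fld] <;>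
    constructor <;> linarith

lemma c1 (T : ℝ) (hT : 0 < T) (f f' : ℝ → ℝ) (h : ∀ t ∈ Icc 0 T, HasDerivAt f (f' t) t)
    (hc : ContinuousOn f' (Icc 0 T)) : ContDiffOn ℝ 1 f (Icc 0 T) := by
  rw [contDiffOn_one_iff_derivWithin (uniqueDiffOn_Icc hT)]
  refine ⟨fun t ht => (h t ht).differentiableAt.differentiableWithinAt, hc.congr fun t ht => ?_⟩
  exact (h t ht).hasDerivWithinAt.derivWithin (uniqueDiffOn_Icc hT t ht)

end TransporterAux



/-- **pointwise transporter dynamics.**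
Let `T > 0`, let `α, β, γf, γb, c : [0,T] → ℝ` be continuous, bounded and nonnegative,
and let `R` be continuous, uniformly `L`-Lipschitz in its second argument and
nonnegative on nonnegative arguments. Then for any nonnegative initial values
`θf⁰, θb⁰` the transporter ODE system has a unique C¹ solution on `[0,T]`; it is
nonnegative and satisfies
`θf(t) + θb(t) ≤ (θf⁰ + θb⁰ + C₀ T) e^{LT}` with `C₀ = sup_{[0,T]} R(·,0)`;
in particular the bound is independent of `c`. -/
theorem transporter_ode_wellposed
    (T : ℝ) (hT : 0 < T)
    (α β γf γb c : ℝ → ℝ)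
    (hαc : Continuous α) (hβc : Continuous β) (hγfc : Continuous γf)
    (hγbc : Continuous γb) (hcc : Continuous c)
    (hαb : ∃ C, ∀ t, |α t| ≤ C) (hβb : ∃ C, ∀ t, |β t| ≤ C)
    (hγfb : ∃ C, ∀ t, |γf t| ≤ C) (hγbb : ∃ C, ∀ t, |γb t| ≤ C)
    (hcb : ∃ C, ∀ t, |c t| ≤ C)
    (hα0 : ∀ t, 0 ≤ α t) (hβ0 : ∀ t, 0 ≤ β t) (hγf0 : ∀ t, 0 ≤ γf t)
    (hγb0 : ∀ t, 0 ≤ γb t) (hc0 : ∀ t, 0 ≤ c t)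
    (R : ℝ → ℝ → ℝ) (hRc : Continuous fun q : ℝ × ℝ => R q.1 q.2)
    (L : ℝ) (hL : 0 ≤ L)
    (hRlip : ∀ t ξ₁ ξ₂, |R t ξ₁ - R t ξ₂| ≤ L * |ξ₁ - ξ₂|)
    (hRpos : ∀ t ξ, 0 ≤ ξ → 0 ≤ R t ξ)
    (θf0 θb0 : ℝ) (hθf0 : 0 ≤ θf0) (hθb0 : 0 ≤ θb0) :
    ∃ θf θb : ℝ → ℝ,
      -- (θf, θb) is a C¹ solution of the system on [0,T] with the given initial values
      ContDiffOn ℝ 1 θf (Icc 0 T) ∧ ContDiffOn ℝ 1 θb (Icc 0 T) ∧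
      (∀ t ∈ Icc 0 T,
        HasDerivAt θf (R t (θf t) - α t * c t * θf t + β t * θb t - γf t * θf t) t ∧
        HasDerivAt θb (α t * c t * θf t - β t * θb t - γb t * θb t) t) ∧
      θf 0 = θf0 ∧ θb 0 = θb0 ∧
      -- nonnegativity and the c-independent a priori bound
      (∀ t ∈ Icc 0 T, 0 ≤ θf t ∧ 0 ≤ θb t ∧
        θf t + θb t ≤
          (θf0 + θb0 + sSup ((fun s => R s 0) '' Icc 0 T) * T) * Real.exp (L * T)) ∧
      -- uniqueness
      (∀ θf' θb' : ℝ → ℝ,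
        (∀ t ∈ Icc 0 T,
          HasDerivAt θf' (R t (θf' t) - α t * c t * θf' t + β t * θb' t - γf t * θf' t) t ∧
          HasDerivAt θb' (α t * c t * θf' t - β t * θb' t - γb t * θb' t) t) →
        θf' 0 = θf0 → θb' 0 = θb0 →
        EqOn θf θf' (Icc 0 T) ∧ EqOn θb θb' (Icc 0 T)) := by
  obtain ⟨A, hA⟩ := hαb
  obtain ⟨B, hB⟩ := hβb
  obtain ⟨F, hF⟩ := hγfb
  obtain ⟨G, hG⟩ := hγbb
  obtain ⟨D, hD⟩ := hcb
  have hAD : ∀ t, |α t * c t| ≤ A * D := fun t => by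
    rw [abs_mul]
    exact mul_le_mul (hA t) (hD t) (abs_nonneg _) ((abs_nonneg _).trans (hA t))
  have lip := fun (φ : ℝ → ℝ) hφ => TransporterAux.fld_lip (fun t => α t * c t) β γf γb R φ L
    (A * D) B F G hL hAD hB hF hG hRlip hφ
  have hRc1 : ∀ ξ, Continuous fun t => R t ξ := fun ξ =>
    hRc.comp (continuous_id.prodMk continuous_const)
  obtain ⟨γ, hγ0, hγ⟩ := TransporterAux.exists_global
    (TransporterAux.fld (fun t => α t * c t) β γf γb R (fun x => max x 0))
    (fun x => by
      have := hRc1 (max x.1 0)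
      unfold TransporterAux.fld
      fun_prop) _
    (lip _ (fun x y => abs_max_sub_max_le_abs x y 0)) T hT (θf0, θb0)
  have hd1 : ∀ t ∈ Icc 0 T, HasDerivAt (fun t => (γ t).1)
      (R t (max (γ t).1 0) - α t * c t * (γ t).1 + β t * max (γ t).2 0 - γf t * (γ t).1) t :=
    fun t ht => (hγ t ht).fst
  have hd2 : ∀ t ∈ Icc 0 T, HasDerivAt (fun t => (γ t).2)
      (α t * c t * max (γ t).1 0 - β t * (γ t).2 - γb t * (γ t).2) t :=
    fun t ht => (hγ t ht).snd
  have hp1 : ∀ t ∈ Icc 0 T, 0 ≤ (γ t).1 := by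
    refine TransporterAux.nonneg_of_deriv T _ _ (fun t => α t * c t + γf t) hd1
      (fun t => add_nonneg (mul_nonneg (hα0 t) (hc0 t)) (hγf0 t)) (fun t _ => ?_) (by simpa [hγ0])
    have h1 := hRpos t (max (γ t).1 0) (le_max_right _ _)
    have h2 := mul_nonneg (hβ0 t) (le_max_right (γ t).2 0)
    linarith
  have hp2 : ∀ t ∈ Icc 0 T, 0 ≤ (γ t).2 := by
    refine TransporterAux.nonneg_of_deriv T _ _ (fun t => β t + γb t) hd2
      (fun t => add_nonneg (hβ0 t) (hγb0 t)) (fun t _ => ?_) (by simpa [hγ0])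
    have h2 := mul_nonneg (mul_nonneg (hα0 t) (hc0 t)) (le_max_right (γ t).1 0)
    linarith
  have he1 : ∀ t ∈ Icc 0 T, HasDerivAt (fun t => (γ t).1)
      (R t (γ t).1 - α t * c t * (γ t).1 + β t * (γ t).2 - γf t * (γ t).1) t := by
    intro t ht
    have := hd1 t ht
    rwa [max_eq_left (hp1 t ht), max_eq_left (hp2 t ht)] at this
  have he2 : ∀ t ∈ Icc 0 T, HasDerivAt (fun t => (γ t).2)
      (α t * c t * (γ t).1 - β t * (γ t).2 - γb t * (γ t).2) t := by
    intro t ht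
    have := hd2 t ht
    rwa [max_eq_left (hp1 t ht)] at this
  have k1 : ContinuousOn (fun t => (γ t).1) (Icc 0 T) :=
    fun t ht => (he1 t ht).continuousAt.continuousWithinAt
  have k2 : ContinuousOn (fun t => (γ t).2) (Icc 0 T) :=
    fun t ht => (he2 t ht).continuousAt.continuousWithinAt
  have kR : ContinuousOn (fun t => R t (γ t).1) (Icc 0 T) :=
    hRc.comp_continuousOn (continuousOn_id.prodMk k1)
  refine ⟨fun t => (γ t).1, fun t => (γ t).2, TransporterAux.c1 T hT _ _ he1 (by fun_prop),
    TransporterAux.c1 T hT _ _ he2 (by fun_prop), fun t ht => ⟨he1 t ht, he2 t ht⟩,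
    by simp [hγ0], by simp [hγ0], fun t ht => ⟨hp1 t ht, hp2 t ht, ?_⟩, ?_⟩
  · set C := sSup ((fun s => R s 0) '' Icc 0 T) with hC
    have hCle : ∀ s ∈ Icc 0 T, R s 0 ≤ C := fun s hs =>
      le_csSup (isCompact_Icc.image (hRc1 0)).bddAbove (mem_image_of_mem _ hs)
    have hC0 : 0 ≤ C := (hRpos 0 0 le_rfl).trans (hCle 0 ⟨le_rfl, hT.le⟩)
    have hexp : ∀ x, HasDerivAt (fun t => Real.exp (-L * t)) (Real.exp (-L * x) * -L) x := by
      intro x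
      simpa using ((hasDerivAt_id x).const_mul (-L)).exp
    have hs := fun x hx => ((he1 x hx).add (he2 x hx)).mul (hexp x)
    have key := image_le_of_deriv_right_le_deriv_boundary (a := 0) (b := T)
      (fun x hx => (hs x hx).continuousAt.continuousWithinAt)
      (fun x hx => (hs x (Ico_subset_Icc_self hx)).hasDerivWithinAt)
      (B := fun t => θf0 + θb0 + C * t) (B' := fun _ => C) (by simp [hγ0])
      (by fun_prop)
      (fun x _ => by
        simpa using (((hasDerivAt_id x).const_mul C).const_add (θf0 + θb0)).hasDerivWithinAt)
      (fun x hx' => by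
        have hx := Ico_subset_Icc_self hx'
        have h1 := abs_le.1 (hRlip x (γ x).1 0)
        rw [sub_zero, abs_of_nonneg (hp1 x hx)] at h1
        have h2 := hCle x hx
        have h3 := mul_nonneg (hγf0 x) (hp1 x hx)
        have h4 := mul_nonneg (hγb0 x) (hp2 x hx)
        have h5 := mul_nonneg hL (hp2 x hx)
        have h6 : Real.exp (-L * x) ≤ 1 := by
          rw [Real.exp_le_one_iff]
          nlinarith [mul_nonneg hL hx.1]
        have h7 := Real.exp_pos (-L * x)
        simp only [Pi.add_apply]
        calc _ = (R x (γ x).1 - γf x * (γ x).1 - γb x * (γ x).2 - L * (γ x).1 - L * (γ x).2)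
              * Real.exp (-L * x) := by ring
          _ ≤ C * Real.exp (-L * x) := by
            apply mul_le_mul_of_nonneg_right _ h7.le
            linarith
          _ ≤ C := mul_le_of_le_one_right hC0 h6) ht
    simp only [Pi.add_apply, Pi.mul_apply] at key
    have e1 : (γ t).1 + (γ t).2
        = ((γ t).1 + (γ t).2) * Real.exp (-L * t) * Real.exp (L * t) := by
      rw [mul_assoc, ← Real.exp_add]
      simp
    rw [e1]
    have h8 : C * t ≤ C * T := mul_le_mul_of_nonneg_left ht.2 hC0
    refine mul_le_mul (by linarith) (Real.exp_le_exp.2 (mul_le_mul_of_nonneg_left ht.2 hL))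
      (Real.exp_pos _).le ?_
    have := mul_nonneg hC0 hT.le
    linarith
  · intro f b hfb hf0 hb0
    have hu : EqOn γ (fun t => (f t, b t)) (Icc 0 T) := by
      refine ODE_solution_unique
        (v := TransporterAux.fld (fun t => α t * c t) β γf γb R id)
        (lip id (fun x y => le_rfl))
        (fun t ht => (hγ t ht).continuousAt.continuousWithinAt)
        (fun t ht => ?_)
        (fun t ht => ((hfb t ht).1.prodMk (hfb t ht).2).continuousAt.continuousWithinAt)
        (fun t ht => ?_) (by simp [hγ0, hf0, hb0])
      · have ht' := Ico_subset_Icc_self ht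
        exact ((he1 t ht').prodMk (he2 t ht')).hasDerivWithinAt
      · have ht' := Ico_subset_Icc_self ht
        exact ((hfb t ht').1.prodMk (hfb t ht').2).hasDerivWithinAt
    exact ⟨fun t ht => congrArg Prod.fst (hu ht), fun t ht => congrArg Prod.snd (hu ht)⟩
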